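/- arXiv:1708.06377 — 2 statements merged into one kernel-verified Lean document; each statement's English description precedes it below -/
import Mathlib

section
/- Let p be a probability kernel on ℤ^d, let p̂(x) := (p(x)+p(−x))/2 be its symmetrized kernel with continuous-time transition kernel p̂_t, and let μ be the probability kernel on ℤ^d × ℤ^d given by μ(u,w) := (1/3)·(p(u)·1_{w=0} + p(w)·1_{u=0} + p(−u)·1_{u=w}). Let P⁽²⁾_t := μ_{3t}, where μ_s is the rate-1 continuous-time kernel of μ. Then for every t ≥ 0 and every x ∈ ℤ^d, the first marginal satisfies ∑_{y∈ℤ^d} P⁽²⁾_t(x,y) = p̂_{2t}(x). -/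
noncomputable def convPow {G : Type*} [AddCommGroup G] [DecidableEq G] (p : G → ℝ) : ℕ → G → ℝ
  | 0 => fun x => if x = 0 then (1 : ℝ) else 0
  | n + 1 => fun x => ∑' y, convPow p n y * p (x - y)

noncomputable def ctKernel {G : Type*} [AddCommGroup G] [DecidableEq G] (p : G → ℝ) (t : ℝ)
    (x : G) : ℝ :=
  Real.exp (-t) * ∑' n : ℕ, t ^ n / (Nat.factorial n : ℝ) * convPow p n x

theorem hasSum_tsum_swap_of_nonneg {α β : Type*} {f : α → β → ℝ} {g : α → ℝ} {s : ℝ}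
    (hf : ∀ a b, 0 ≤ f a b) (hfg : ∀ a, HasSum (f a) (g a)) (hg : HasSum g s) :
    HasSum (fun b => ∑' a, f a b) s := by
  have hsum : Summable (fun z : α × β => f z.1 z.2) := by
    refine (summable_prod_of_nonneg fun z => hf z.1 z.2).2 ⟨fun a => (hfg a).summable, ?_⟩
    simpa only [(hfg _).tsum_eq] using hg.summable
  have hs : ∑' z : α × β, f z.1 z.2 = s := by
    rw [hsum.tsum_prod]
    simpa only [(hfg _).tsum_eq] using hg.tsum_eq
  have hswap : HasSum (fun z : β × α => f z.2 z.1) s :=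
    (Equiv.prodComm β α).hasSum_iff (f := fun z : α × β => f z.1 z.2) |>.2 (hs ▸ hsum.hasSum)
  exact hswap.prod_fiberwise fun b => (hswap.summable.prod_factor b).hasSum

theorem le_of_hasSum_one {α : Type*} {q : α → ℝ} (hq : ∀ x, 0 ≤ q x) (hq1 : HasSum q 1) (x : α) :
    q x ≤ 1 :=
  le_hasSum hq1 x fun y _ => hq y

section ConvPow

variable {G K : Type*} [AddCommGroup G] [DecidableEq G] [AddCommGroup K] [DecidableEq K]

theorem convPow_nonneg {q : G → ℝ} (hq : ∀ x, 0 ≤ q x) (n : ℕ) (x : G) : 0 ≤ convPow q n x := by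
  induction n generalizing x with
  | zero => simp only [convPow]; split_ifs <;> norm_num
  | succ n ih => exact tsum_nonneg fun y => mul_nonneg (ih y) (hq _)

theorem hasSum_convPow {q : G → ℝ} (hq : ∀ x, 0 ≤ q x) (hq1 : HasSum q 1) (n : ℕ) :
    HasSum (convPow q n) 1 := by
  induction n with
  | zero => simpa only [convPow] using hasSum_ite_eq (0 : G) (1 : ℝ)
  | succ n ih =>
    refine hasSum_tsum_swap_of_nonneg (fun y x => mul_nonneg (convPow_nonneg hq n y) (hq _))
      (fun y => ?_) ih
    simpa using ((Equiv.subRight y).hasSum_iff.2 hq1).mul_left (convPow q n y)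

theorem summable_convPow_mul {q r : G → ℝ} (hq : ∀ x, 0 ≤ q x) (hq1 : HasSum q 1)
    (hr : ∀ x, 0 ≤ r x) (hr1 : HasSum r 1) (n : ℕ) (x : G) :
    Summable fun y => convPow q n y * r (x - y) :=
  Summable.of_nonneg_of_le (fun y => mul_nonneg (convPow_nonneg hq n y) (hr _))
    (fun y => mul_le_of_le_one_right (convPow_nonneg hq n y) (le_of_hasSum_one hr hr1 _))
    (hasSum_convPow hq hq1 n).summable

theorem summable_exp_series_convPow {q : G → ℝ} (hq : ∀ x, 0 ≤ q x) (hq1 : HasSum q 1)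
    (t : ℝ) (x : G) :
    Summable fun n : ℕ => ‖t ^ n / (n.factorial : ℝ) * convPow q n x‖ := by
  refine Summable.of_nonneg_of_le (fun n => norm_nonneg _) (fun n => ?_)
    (Real.summable_pow_div_factorial t).norm
  rw [norm_mul, Real.norm_of_nonneg (convPow_nonneg hq n x)]
  exact mul_le_of_le_one_right (norm_nonneg _)
    (le_of_hasSum_one (convPow_nonneg hq n) (hasSum_convPow hq hq1 n) x)

/-- The first marginal of a convolution power is the convolution power of the first marginal. -/
theorem hasSum_convPow_fst {m : G × K → ℝ} {q : G → ℝ} (hm : ∀ z, 0 ≤ m z) (hm1 : HasSum m 1)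
    (hmq : ∀ x, HasSum (fun y => m (x, y)) (q x)) (n : ℕ) (x : G) :
    HasSum (fun y => convPow m n (x, y)) (convPow q n x) := by
  have hq : ∀ x, 0 ≤ q x := fun x => (hmq x).nonneg fun y => hm _
  have hq1 : HasSum q 1 := hm1.prod_fiberwise hmq
  induction n generalizing x with
  | zero =>
    by_cases hx : x = 0
    · simpa [convPow, Prod.ext_iff, hx] using hasSum_ite_eq (0 : K) (1 : ℝ)
    · simp [convPow, Prod.ext_iff, hx]
  | succ n ih =>
    have hg : Summable fun z : G × K => convPow m n z * q (x - z.1) :=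
      Summable.of_nonneg_of_le (fun z => mul_nonneg (convPow_nonneg hm n z) (hq _))
        (fun z => mul_le_of_le_one_right (convPow_nonneg hm n z) (le_of_hasSum_one hq hq1 _))
        (hasSum_convPow hm hm1 n).summable
    have hs := (hg.hasSum.prod_fiberwise fun a => (ih a).mul_right (q (x - a))).tsum_eq
    refine hasSum_tsum_swap_of_nonneg
      (f := fun (z : G × K) (y : K) => convPow m n z * m ((x, y) - z))
      (fun z y => mul_nonneg (convPow_nonneg hm n z) (hm _)) (fun z => ?_) (hs ▸ hg.hasSum)
    exact ((Equiv.subRight z.2).hasSum_iff.2 (hmq (x - z.1))).mul_left (convPow m n z)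

theorem hasSum_ctKernel_fst {m : G × K → ℝ} {q : G → ℝ} (hm : ∀ z, 0 ≤ m z) (hm1 : HasSum m 1)
    (hmq : ∀ x, HasSum (fun y => m (x, y)) (q x)) {t : ℝ} (ht : 0 ≤ t) (x : G) :
    HasSum (fun y => ctKernel m t (x, y)) (ctKernel q t x) := by
  refine HasSum.mul_left _ (hasSum_tsum_swap_of_nonneg
    (fun n y => mul_nonneg (by positivity) (convPow_nonneg hm n _))
    (fun n => (hasSum_convPow_fst hm hm1 hmq n x).mul_left _) ?_)
  exact (summable_exp_series_convPow (fun x => (hmq x).nonneg fun y => hm _)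
    (hm1.prod_fiberwise hmq) t x).of_norm.hasSum

/-- Binomial expansion of the convolution powers of a lazy kernel. -/
theorem convPow_lazy {q r : G → ℝ} (hq : ∀ x, 0 ≤ q x) (hq1 : HasSum q 1) {b c : ℝ}
    (hr : ∀ x, r x = b * q x + c * (if x = 0 then 1 else 0)) (n : ℕ) (x : G) :
    convPow r n x = ∑ ij ∈ Finset.HasAntidiagonal.antidiagonal n,
      (n.choose ij.1 : ℝ) * (b ^ ij.1 * c ^ ij.2 * convPow q ij.1 x) := by
  induction n generalizing x with
  | zero => simp [convPow]
  | succ n ih =>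
    rw [Finset.sum_antidiagonal_choose_succ_mul
      (fun i j => b ^ i * c ^ j * convPow q i x) n]
    have hstep (i : ℕ) : HasSum (fun y => convPow q i y * r (x - y))
        (b * convPow q (i + 1) x + c * convPow q i x) := by
      have h1 : HasSum (fun y => b * (convPow q i y * q (x - y))) (b * convPow q (i + 1) x) :=
        (summable_convPow_mul hq hq1 hq hq1 i x).hasSum.mul_left b
      have h2 : HasSum (fun y => if y = x then c * convPow q i x else 0) (c * convPow q i x) :=
        hasSum_ite_eq x _
      refine (h1.add h2).congr_fun fun y => ?_
      rw [hr]
      by_cases h : y = x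
      · subst h; simp; ring
      · simp [h, sub_eq_zero, Ne.symm h]; ring
    have hsum := hasSum_sum (s := Finset.HasAntidiagonal.antidiagonal n)
      (fun ij _ => (hstep ij.1).mul_left ((n.choose ij.1 : ℝ) * (b ^ ij.1 * c ^ ij.2)))
    have hexp : convPow r (n + 1) x = ∑ ij ∈ Finset.HasAntidiagonal.antidiagonal n,
        (n.choose ij.1 : ℝ) * (b ^ ij.1 * c ^ ij.2) *
          (b * convPow q (ij.1 + 1) x + c * convPow q ij.1 x) := by
      rw [← hsum.tsum_eq]
      refine tsum_congr fun y => ?_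
      rw [ih, Finset.sum_mul]
      exact Finset.sum_congr rfl fun ij _ => by ring
    rw [hexp, ← Finset.sum_add_distrib]
    refine Finset.sum_congr rfl fun ij hij => ?_
    rw [← Nat.choose_symm_of_eq_add (Finset.HasAntidiagonal.mem_antidiagonal.1 hij).symm]
    ring

/-- A lazy walk run at rate one is the original walk run at a reduced rate. -/
theorem ctKernel_lazy {q r : G → ℝ} (hq : ∀ x, 0 ≤ q x) (hq1 : HasSum q 1) {b c : ℝ}
    (hbc : b + c = 1) (hr : ∀ x, r x = b * q x + c * (if x = 0 then 1 else 0)) (t : ℝ) (x : G) :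
    ctKernel r t x = ctKernel q (b * t) x := by
  have hexp : Real.exp (c * t) = ∑' n : ℕ, (c * t) ^ n / (n.factorial : ℝ) := by
    rw [Real.exp_eq_exp_ℝ, NormedSpace.exp_eq_tsum_div]
  have hcauchy := tsum_mul_tsum_eq_tsum_sum_antidiagonal_of_summable_norm
    (summable_exp_series_convPow hq hq1 (b * t) x) (Real.summable_pow_div_factorial (c * t)).norm
  have hseries : ∑' n : ℕ, t ^ n / (n.factorial : ℝ) * convPow r n x =
      (∑' n : ℕ, (b * t) ^ n / (n.factorial : ℝ) * convPow q n x) * Real.exp (c * t) := by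
    rw [hexp, hcauchy]
    refine tsum_congr fun n => ?_
    rw [convPow_lazy hq hq1 hr, Finset.mul_sum]
    refine Finset.sum_congr rfl fun ij hij => ?_
    obtain ⟨i, j⟩ := ij
    obtain rfl : i + j = n := Finset.HasAntidiagonal.mem_antidiagonal.1 hij
    have hi : (i.factorial : ℝ) ≠ 0 := by positivity
    have hj : (j.factorial : ℝ) ≠ 0 := by positivity
    have hij : ((i + j).factorial : ℝ) ≠ 0 := by positivity
    rw [Nat.cast_add_choose]
    field_simp
    ring
  have hbt : -(b * t) = -t + c * t := by linear_combination -t * hbc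
  rw [ctKernel, ctKernel, hseries, hbt, Real.exp_add]
  ring

end ConvPow

/-- with `μ(u,w) = (1/3)(p(u)1_{w=0} + p(w)1_{u=0} + p(−u)1_{u=w})` and
`P⁽²⁾_t = μ_{3t}`, the first marginal satisfies `∑_y P⁽²⁾_t(x,y) = p̂_{2t}(x)`. -/
theorem stmt_11 (d : ℕ) (hd : 1 ≤ d)
    (p : (Fin d → ℤ) → ℝ) (hp : ∀ x, 0 ≤ p x) (hp1 : ∑' x, p x = 1)
    (phat : (Fin d → ℤ) → ℝ) (hphat : ∀ x, phat x = (p x + p (-x)) / 2)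
    (μ : (Fin d → ℤ) × (Fin d → ℤ) → ℝ)
    (hμ : ∀ u w : Fin d → ℤ, μ (u, w) = (1 / 3 : ℝ) *
      (p u * (if w = 0 then 1 else 0) + p w * (if u = 0 then 1 else 0) +
        p (-u) * (if u = w then 1 else 0))) :
    ∀ t : ℝ, 0 ≤ t → ∀ x : Fin d → ℤ,
      Summable (fun y : Fin d → ℤ => ctKernel μ (3 * t) (x, y)) ∧
      ∑' y : Fin d → ℤ, ctKernel μ (3 * t) (x, y) = ctKernel phat (2 * t) x := by
  intro t ht x
  have hps : HasSum p 1 := by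
    have hs : Summable p := by
      by_contra h
      simp [tsum_eq_zero_of_not_summable h] at hp1
    exact hp1 ▸ hs.hasSum
  have hq : ∀ x, 0 ≤ phat x := fun x => by
    rw [hphat]; linarith [hp x, hp (-x)]
  have hq1 : HasSum phat 1 := by
    have h := (hps.add ((Equiv.neg (Fin d → ℤ)).hasSum_iff.2 hps)).div_const 2
    norm_num at h
    exact h.congr_fun hphat
  have hm : ∀ z, 0 ≤ μ z := by
    rintro ⟨u, w⟩
    have := hp u
    have := hp w
    have := hp (-u)
    rw [hμ]
    positivity
  obtain ⟨r, hr⟩ : ∃ r : (Fin d → ℤ) → ℝ,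
      ∀ x, r x = 2 / 3 * phat x + 1 / 3 * (if x = 0 then 1 else 0) := ⟨_, fun _ => rfl⟩
  have hmr : ∀ x, HasSum (fun y => μ (x, y)) (r x) := fun x => by
    have h1 : HasSum (fun w : Fin d → ℤ => p x * (if w = 0 then 1 else 0)) (p x * 1) :=
      (hasSum_ite_eq (0 : Fin d → ℤ) (1 : ℝ)).mul_left _
    have h2 : HasSum (fun w : Fin d → ℤ => p w * (if x = 0 then 1 else 0)) (1 * (if x = 0 then 1 else 0)) :=
      hps.mul_right _
    have h3 : HasSum (fun w : Fin d → ℤ => p (-x) * (if w = x then 1 else 0)) (p (-x) * 1) :=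
      (hasSum_ite_eq x (1 : ℝ)).mul_left _
    have hval : r x = 1 / 3 * (p x * 1 + 1 * (if x = 0 then 1 else 0) + p (-x) * 1) := by
      rw [hr, hphat]; ring
    rw [hval]
    refine (((h1.add h2).add h3).mul_left (1 / 3)).congr_fun fun w => ?_
    simp only [hμ, eq_comm (a := x) (b := w)]
  have hr1 : HasSum r 1 := by
    have h := (hq1.mul_left (2 / 3)).add
      ((hasSum_ite_eq (0 : Fin d → ℤ) (1 : ℝ)).mul_left (1 / 3))
    norm_num at h
    exact h.congr_fun fun x => by rw [hr]; norm_num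
  have hm1 : HasSum μ 1 := by
    have hs : Summable μ := (summable_prod_of_nonneg hm).2
      ⟨fun x => (hmr x).summable, by simpa only [(hmr _).tsum_eq] using hr1.summable⟩
    exact (hs.hasSum.prod_fiberwise hmr).unique hr1 ▸ hs.hasSum
  have hmain := hasSum_ctKernel_fst hm hm1 hmr (by positivity : 0 ≤ 3 * t) x
  refine ⟨hmain.summable, hmain.tsum_eq.trans ?_⟩
  rw [ctKernel_lazy hq hq1 (by norm_num) hr]
  congr 1
  ring
end

section
/- Let p be a probability kernel on ℤ^d with continuous-time transition kernel p_t, let T > 0, x₀ ∈ ℤ^d, and let t ∈ [0,T) be such that p_{T−t}(z) > 0 for all z ∈ ℤ^d. Let η : ℤ^d → ℕ be finitely supported, let z₀ ∈ ℤ^d with η(z₀) ≥ 1, and set s_x(η,t) := p_{T−t}(x₀−x) / ∑_z η(z)·p_{T−t}(x₀−z). Then the function t ↦ s_{z₀}(η,t) is differentiable at t and ((∂/∂t)s_{z₀}(η,t))/s_{z₀}(η,t) + ∑_{x,y∈ℤ^d} η(x)·p(y−x)·( s_x(η,t) − s_y(η,t) − 1_{x=z₀}/η(z₀) ) = − ∑_{y∈ℤ^d}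 p(y−z₀)·s_y(η,t)/s_{z₀}(η,t), all series converging absolutely. -/
theorem convPow_nonneg_hasSum {G : Type*} [AddCommGroup G] [DecidableEq G] {p : G → ℝ}
    (hp : ∀ x, 0 ≤ p x) (hp1 : HasSum p 1) (n : ℕ) :
    (∀ x, 0 ≤ convPow p n x) ∧ HasSum (convPow p n) 1 := by
  induction n with
  | zero =>
    refine ⟨fun x => ?_, ?_⟩
    · simp only [convPow]
      split_ifs <;> norm_num
    · simpa [convPow] using hasSum_ite_eq (0 : G) (1 : ℝ)
  | succ n ih =>
    obtain ⟨h0, h1⟩ := ih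
    refine ⟨fun x => tsum_nonneg fun y => mul_nonneg (h0 y) (hp _), ?_⟩
    have hs : HasSum (fun z : G × G => convPow p n z.1 * p z.2) 1 := by
      simpa using h1.mul hp1 (h1.summable.mul_of_nonneg hp1.summable h0 hp)
    let e : G × G ≃ G × G :=
      { toFun := fun z => (z.2, z.1 - z.2)
        invFun := fun z => (z.1 + z.2, z.1)
        left_inv := fun z => by simp
        right_inv := fun z => by simp }
    have hs' : HasSum (fun z : G × G => convPow p n z.2 * p (z.1 - z.2)) 1 :=
      (e.hasSum_iff (f := fun z : G × G => convPow p n z.1 * p z.2)).2 hs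
    exact hs'.prod_fiberwise fun x => (hs'.summable.prod_factor x).hasSum

theorem hasDerivAt_tsum_pow_div_factorial {a : ℕ → ℝ} (ha : ∀ n, |a n| ≤ 1) (t : ℝ) :
    HasDerivAt (fun u : ℝ => ∑' n : ℕ, u ^ n / (Nat.factorial n : ℝ) * a n)
      (∑' n : ℕ, t ^ n / (Nat.factorial n : ℝ) * a (n + 1)) t := by
  set R : ℝ := |t| + 1 with hR
  have hR0 : 0 ≤ R := by positivity
  have hshift (u : ℝ) (n : ℕ) : ((n + 1 : ℕ) : ℝ) * u ^ (n + 1 - 1) / (Nat.factorial (n + 1) : ℝ) =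
      u ^ n / (Nat.factorial n : ℝ) := by
    rw [Nat.factorial_succ, Nat.add_sub_cancel]
    push_cast
    have : (Nat.factorial n : ℝ) ≠ 0 := by positivity
    field_simp
  have hsum : Summable fun n : ℕ => (n : ℝ) * R ^ (n - 1) / (Nat.factorial n : ℝ) := by
    rw [← summable_nat_add_iff 1]
    simpa only [hshift] using Real.summable_pow_div_factorial R
  have hbound (n : ℕ) (u : ℝ) (hu : u ∈ Metric.ball (0 : ℝ) R) :
      ‖(n : ℝ) * u ^ (n - 1) / (Nat.factorial n : ℝ) * a n‖ ≤
        (n : ℝ) * R ^ (n - 1) / (Nat.factorial n : ℝ) := by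
    have hu' : |u| ≤ R := by
      rw [mem_ball_zero_iff, Real.norm_eq_abs] at hu
      exact hu.le
    rw [norm_mul, Real.norm_eq_abs, Real.norm_eq_abs, abs_div, abs_mul, abs_pow, Nat.abs_cast,
      Nat.abs_cast]
    calc (n : ℝ) * |u| ^ (n - 1) / (Nat.factorial n : ℝ) * |a n|
        ≤ (n : ℝ) * |u| ^ (n - 1) / (Nat.factorial n : ℝ) * 1 := by
          gcongr
          exact ha n
      _ ≤ (n : ℝ) * R ^ (n - 1) / (Nat.factorial n : ℝ) := by
          rw [mul_one]
          gcongr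
  have htR : t ∈ Metric.ball (0 : ℝ) R := by
    rw [mem_ball_zero_iff, Real.norm_eq_abs, hR]
    linarith
  have hzero : Summable fun n : ℕ => (0 : ℝ) ^ n / (Nat.factorial n : ℝ) * a n := by
    refine summable_of_ne_finset_zero (s := {0}) fun n hn => ?_
    rw [Finset.mem_singleton] at hn
    simp [hn]
  have h := hasDerivAt_tsum_of_isPreconnected hsum Metric.isOpen_ball
    (convex_ball (0 : ℝ) R).isPreconnected
    (g := fun n u => u ^ n / (Nat.factorial n : ℝ) * a n)
    (g' := fun n u => (n : ℝ) * u ^ (n - 1) / (Nat.factorial n : ℝ) * a n)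
    (fun n u _ => ((hasDerivAt_pow n u).div_const _).mul_const _) hbound
    (Metric.mem_ball_self (by positivity)) hzero htR
  refine h.congr_deriv ?_
  rw [(Summable.of_norm_bounded hsum fun n => hbound n t htR).tsum_eq_zero_add]
  simp only [hshift]
  simp

theorem ctKernel_hasDerivAt {G : Type*} [AddCommGroup G] [DecidableEq G] {p : G → ℝ}
    (hp : ∀ x, 0 ≤ p x) (hp1 : HasSum p 1) (t : ℝ) (x : G) :
    ∃ A : ℝ, HasSum (fun y => ctKernel p t y * p (x - y)) A ∧
      HasDerivAt (fun u => ctKernel p u x) (A - ctKernel p t x) t := by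
  have h0 n := (convPow_nonneg_hasSum hp hp1 n).1
  have h1 n := (convPow_nonneg_hasSum hp hp1 n).2
  have hp_le (z : G) : p z ≤ 1 := le_hasSum hp1 z fun j _ => hp j
  have hc_le (n : ℕ) : |convPow p n x| ≤ 1 := by
    rw [abs_of_nonneg (h0 n x)]
    exact le_hasSum (h1 n) x fun j _ => h0 n j
  have hmaj : Summable fun z : ℕ × G => |t| ^ z.1 / (Nat.factorial z.1 : ℝ) * convPow p z.1 z.2 := by
    have hnonneg : 0 ≤ fun z : ℕ × G =>
        |t| ^ z.1 / (Nat.factorial z.1 : ℝ) * convPow p z.1 z.2 := by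
      rw [Pi.le_def]
      exact fun z => mul_nonneg (by positivity) (h0 z.1 z.2)
    refine (summable_prod_of_nonneg hnonneg).2 ⟨fun n => (h1 n).summable.mul_left (|t| ^ n / (Nat.factorial n : ℝ)), ?_⟩
    simpa only [tsum_mul_left, (h1 _).tsum_eq, mul_one] using Real.summable_pow_div_factorial |t|
  have hsum : Summable fun z : ℕ × G =>
      t ^ z.1 / (Nat.factorial z.1 : ℝ) * (convPow p z.1 z.2 * p (x - z.2)) := by
    refine Summable.of_norm_bounded hmaj fun z => ?_
    rw [norm_mul, norm_div, norm_pow, Real.norm_natCast, Real.norm_eq_abs, Real.norm_eq_abs,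
      abs_of_nonneg (mul_nonneg (h0 _ _) (hp _))]
    gcongr
    exact mul_le_of_le_one_right (h0 _ _) (hp_le _)
  have hswap := hsum.prod_symm.hasSum.prod_fiberwise
    (g := fun y => (∑' n : ℕ, t ^ n / (Nat.factorial n : ℝ) * convPow p n y) * p (x - y))
    fun y => by
      rw [← tsum_mul_right]
      simpa only [Prod.swap_prod_mk, mul_assoc] using (hsum.prod_symm.prod_factor y).hasSum
  have htot : ∑' z : G × ℕ, t ^ z.swap.1 / (Nat.factorial z.swap.1 : ℝ) *
        (convPow p z.swap.1 z.swap.2 * p (x - z.swap.2)) =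
      ∑' n : ℕ, t ^ n / (Nat.factorial n : ℝ) * convPow p (n + 1) x := by
    refine ((Equiv.prodComm G ℕ).tsum_eq fun z : ℕ × G =>
      t ^ z.1 / (Nat.factorial z.1 : ℝ) * (convPow p z.1 z.2 * p (x - z.2))).trans ?_
    rw [hsum.tsum_prod]
    simp only [tsum_mul_left, convPow]
  rw [htot] at hswap
  refine ⟨_, by simpa only [ctKernel, mul_assoc] using hswap.mul_left (Real.exp (-t)), ?_⟩
  have hd := (hasDerivAt_neg t).exp.mul (hasDerivAt_tsum_pow_div_factorial hc_le t)
  refine hd.congr_deriv ?_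
  simp only [ctKernel]
  ring

theorem hasSum_prod_of_left_support {X Y : Type*} {F : X × Y → ℝ} {g : X → ℝ} (s : Finset X)
    (hF : ∀ x, HasSum (fun y => F (x, y)) (g x)) (hs : ∀ x ∉ s, ∀ y, F (x, y) = 0) :
    HasSum F (∑ x ∈ s, g x) := by
  classical
  have hx (x : X) : HasSum (fun z : X × Y => if z.1 = x then F z else 0) (g x) := by
    rw [← (Prod.mk_right_injective x).hasSum_iff]
    · simpa [Function.comp_def] using hF x
    · rintro ⟨x', y⟩ hz
      exact if_neg fun h => hz ⟨y, by simp_all⟩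
  convert hasSum_sum fun x (_ : x ∈ s) => hx x with z
  rw [Finset.sum_ite_eq]
  split_ifs with h
  · rfl
  · exact hs z.1 h z.2

/-- with `s_x(η,u) = p_{T−u}(x₀−x)/∑_z η(z) p_{T−u}(x₀−z)`, the function
`u ↦ s_{z₀}(η,u)` is differentiable at `t` and
`(∂_t s_{z₀})/s_{z₀} + ∑_{x,y} η(x) p(y−x)(s_x − s_y − 1_{x=z₀}/η(z₀))
  = −∑_y p(y−z₀) s_y/s_{z₀}`, all series converging absolutely. -/
theorem stmt_18 (d : ℕ) (hd : 1 ≤ d)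
    (p : (Fin d → ℤ) → ℝ) (hp : ∀ x, 0 ≤ p x) (hp1 : ∑' x, p x = 1)
    (T : ℝ) (hT : 0 < T) (x₀ : Fin d → ℤ)
    (t : ℝ) (ht0 : 0 ≤ t) (htT : t < T)
    (hpos : ∀ z : Fin d → ℤ, 0 < ctKernel p (T - t) z)
    (η : (Fin d → ℤ) →₀ ℕ) (z₀ : Fin d → ℤ) (hz₀ : 1 ≤ η z₀)
    (S : (Fin d → ℤ) → ℝ → ℝ)
    (hS : ∀ x u, S x u =
      ctKernel p (T - u) (x₀ - x) / ∑' z : Fin d → ℤ, (η z : ℝ) * ctKernel p (T - u) (x₀ - z)) :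
    (Summable fun xy : (Fin d → ℤ) × (Fin d → ℤ) =>
      (η xy.1 : ℝ) * p (xy.2 - xy.1) *
        (S xy.1 t - S xy.2 t - (if xy.1 = z₀ then 1 else 0) / (η z₀ : ℝ))) ∧
    (Summable fun y : Fin d → ℤ => p (y - z₀) * S y t / S z₀ t) ∧
    ∃ ds : ℝ, HasDerivAt (S z₀) ds t ∧
      ds / S z₀ t
        + (∑' xy : (Fin d → ℤ) × (Fin d → ℤ),
            (η xy.1 : ℝ) * p (xy.2 - xy.1) *
              (S xy.1 t - S xy.2 t - (if xy.1 = z₀ then 1 else 0) / (η z₀ : ℝ)))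
      = -∑' y : Fin d → ℤ, p (y - z₀) * S y t / S z₀ t := by
  have hps : HasSum p 1 := by
    rw [← hp1]
    refine Summable.hasSum (by_contra fun h => ?_)
    rw [tsum_eq_zero_of_not_summable h] at hp1
    exact zero_ne_one hp1
  choose B hB hB' using fun x => ctKernel_hasDerivAt hp hps (T - t) (x₀ - x)
  set f : (Fin d → ℤ) → ℝ := fun x => ctKernel p (T - t) (x₀ - x) with hf
  have hA (x : Fin d → ℤ) : HasSum (fun y => p (y - x) * f y) (B x) := by
    have h := (Equiv.subLeft x₀).hasSum_iff.2 (hB x)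
    simpa [Function.comp_def, hf, mul_comm] using h
  have hf' (x : Fin d → ℤ) :
      HasDerivAt (fun u => ctKernel p (T - u) (x₀ - x)) (f x - B x) t := by
    have h := (hB' x).comp t ((hasDerivAt_id t).const_sub T)
    exact h.congr_deriv (by simp [hf])
  have htsum (u : ℝ) : ∑' z, (η z : ℝ) * ctKernel p (T - u) (x₀ - z) =
      ∑ z ∈ η.support, (η z : ℝ) * ctKernel p (T - u) (x₀ - z) :=
    tsum_eq_sum fun z hz => by simp [Finsupp.notMem_support_iff.1 hz]
  set D : ℝ := ∑ z ∈ η.support, (η z : ℝ) * f z with hD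
  have hz₀s : z₀ ∈ η.support := Finsupp.mem_support_iff.2 (by omega)
  have hη₀ : (0 : ℝ) < η z₀ := by exact_mod_cast hz₀
  have hfpos (x : Fin d → ℤ) : 0 < f x := hpos _
  have hDpos : 0 < D :=
    Finset.sum_pos' (fun z _ => mul_nonneg (Nat.cast_nonneg _) (hfpos z).le)
      ⟨z₀, hz₀s, mul_pos hη₀ (hfpos z₀)⟩
  have hSt (x : Fin d → ℤ) : S x t = f x / D := by rw [hS, htsum]
  have hSum (x : Fin d → ℤ) : HasSum (fun y => p (y - x) * S y t) (B x / D) := by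
    simpa only [hSt, mul_div_assoc] using (hA x).div_const D
  have hp_shift (x : Fin d → ℤ) : HasSum (fun y => p (y - x)) 1 :=
    (Equiv.subRight x).hasSum_iff.2 hps
  have hinner (x : Fin d → ℤ) : HasSum (fun y => (η x : ℝ) * p (y - x) *
      (S x t - S y t - (if x = z₀ then 1 else 0) / (η z₀ : ℝ)))
      ((η x : ℝ) * (f x / D - (if x = z₀ then 1 else 0) / (η z₀ : ℝ) - B x / D)) := by
    have h := (((hp_shift x).mul_right
      (S x t - (if x = z₀ then 1 else 0) / (η z₀ : ℝ))).sub (hSum x)).mul_left (η x : ℝ)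
    rw [one_mul, hSt x] at h
    rw [hSt x]
    exact h.congr_fun fun y => by ring
  have hdouble := hasSum_prod_of_left_support (F := fun xy : (Fin d → ℤ) × (Fin d → ℤ) =>
      (η xy.1 : ℝ) * p (xy.2 - xy.1) *
        (S xy.1 t - S xy.2 t - (if xy.1 = z₀ then 1 else 0) / (η z₀ : ℝ)))
    η.support hinner fun x hx y => by simp [Finsupp.notMem_support_iff.1 hx]
  have hright := (hSum z₀).div_const (S z₀ t)
  have hD' : HasDerivAt (fun u => ∑ z ∈ η.support, (η z : ℝ) * ctKernel p (T - u) (x₀ - z))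
      (∑ z ∈ η.support, (η z : ℝ) * (f z - B z)) t :=
    HasDerivAt.fun_sum fun z _ => (hf' z).const_mul _
  have hS' : HasDerivAt (S z₀) (((f z₀ - B z₀) * D -
      f z₀ * ∑ z ∈ η.support, (η z : ℝ) * (f z - B z)) / D ^ 2) t := by
    have hfun : S z₀ = fun u => ctKernel p (T - u) (x₀ - z₀) /
        ∑ z ∈ η.support, (η z : ℝ) * ctKernel p (T - u) (x₀ - z) :=
      funext fun u => by rw [hS, htsum]
    rw [hfun]
    exact (hf' z₀).fun_div hD' hDpos.ne'
  refine ⟨hdouble.summable, hright.summable, _, hS', ?_⟩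
  have hfinite : ∑ x ∈ η.support,
      (η x : ℝ) * (f x / D - (if x = z₀ then 1 else 0) / (η z₀ : ℝ) - B x / D) =
      (∑ z ∈ η.support, (η z : ℝ) * (f z - B z)) / D - 1 := by
    have hone : ∑ x ∈ η.support, (η x : ℝ) * ((if x = z₀ then 1 else 0) / (η z₀ : ℝ)) = 1 := by
      rw [Finset.sum_eq_single_of_mem z₀ hz₀s fun x _ hx => by simp [hx]]
      simp [hη₀.ne']
    calc _ = ∑ x ∈ η.support, ((η x : ℝ) * (f x - B x) / D -
          (η x : ℝ) * ((if x = z₀ then 1 else 0) / (η z₀ : ℝ))) :=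
          Finset.sum_congr rfl fun x _ => by ring
      _ = _ := by rw [Finset.sum_sub_distrib, hone, Finset.sum_div]
  rw [hdouble.tsum_eq, hright.tsum_eq, hfinite, hSt]
  have := (hfpos z₀).ne'
  have := hDpos.ne'
  field_simp
  ring
end
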